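/- Let u : ℂ → ℝ be a smooth solution of the sinh-Gordon equation ∂∂̄u + (1/2) sinh(2u) = 0. Then both ω₁ = ∂u and ω₂ = ∂³u − 2(∂u)³ solve the homogeneous Jacobi equation: ∂̄∂ω₁ + cosh(2u) ω₁ = 0 and ∂̄∂ω₂ + cosh(2u) ω₂ = 0 hold identically on ℂ. -/

import Mathlib

noncomputable section

open Complex Matrix

/-- Wirtinger derivative `∂f = (1/2)(f_x - i f_y)`. -/
def wd (f : ℂ → ℂ) (z : ℂ) : ℂ :=
  (fderiv ℝ f z 1 - Complex.I * fderiv ℝ f z Complex.I) / 2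

/-- Conjugate Wirtinger derivative `∂̄f = (1/2)(f_x + i f_y)`. -/
def wdb (f : ℂ → ℂ) (z : ℂ) : ℂ :=
  (fderiv ℝ f z 1 + Complex.I * fderiv ℝ f z Complex.I) / 2

/-- Complexification of a real-valued function. -/
def cx (u : ℂ → ℝ) : ℂ → ℂ := fun z => (u z : ℂ)

/-- Entrywise Wirtinger derivative of a matrix-valued function. -/
def mwd (F : ℂ → Matrix (Fin 2) (Fin 2) ℂ) (z : ℂ) : Matrix (Fin 2) (Fin 2) ℂ :=
  Matrix.of fun i j => wd (fun w => F w i j) z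

/-- Entrywise conjugate Wirtinger derivative of a matrix-valued function. -/
def mwdb (F : ℂ → Matrix (Fin 2) (Fin 2) ℂ) (z : ℂ) : Matrix (Fin 2) (Fin 2) ℂ :=
  Matrix.of fun i j => wdb (fun w => F w i j) z

/-- Entrywise Wirtinger derivative of a vector-valued function. -/
def vwd (v : ℂ → Fin 2 → ℂ) (z : ℂ) : Fin 2 → ℂ := fun i => wd (fun w => v w i) z

/-- Entrywise conjugate Wirtinger derivative of a vector-valued function. -/
def vwdb (v : ℂ → Fin 2 → ℂ) (z : ℂ) : Fin 2 → ℂ := fun i => wdb (fun w => v w i) z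

/-- `u` solves the sinh-Gordon equation `∂∂̄u + (1/2) sinh (2u) = 0`. -/
def SinhGordon (u : ℂ → ℝ) : Prop :=
  ∀ z, wd (wdb (cx u)) z + (1/2) * Complex.sinh (2 * (u z : ℂ)) = 0

/-- `(ψ₁, ψ₂)` solves the system `(Ψ_λ)`. -/
def SolPsi (u : ℂ → ℝ) (lam : ℂ) (p1 p2 : ℂ → ℂ) : Prop :=
  ContDiff ℝ (⊤ : ℕ∞) p1 ∧ ContDiff ℝ (⊤ : ℕ∞) p2 ∧
  (∀ z, wd p1 z = (1/2) * (wd (cx u) z * p1 z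
      + Complex.I * Complex.exp (-(u z : ℂ)) * p2 z)) ∧
  (∀ z, wd p2 z = (1/2) * (Complex.I * lam⁻¹ * Complex.exp ((u z : ℂ)) * p1 z
      - wd (cx u) z * p2 z)) ∧
  (∀ z, wdb p1 z = (1/2) * (-(wdb (cx u) z) * p1 z
      + Complex.I * lam * Complex.exp ((u z : ℂ)) * p2 z)) ∧
  (∀ z, wdb p2 z = (1/2) * (Complex.I * Complex.exp (-(u z : ℂ)) * p1 z
      + wdb (cx u) z * p2 z))

/-- `(φ₁, φ₂)` solves the system `(Φ_λ)`. -/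
def SolPhi (u : ℂ → ℝ) (lam : ℂ) (f1 f2 : ℂ → ℂ) : Prop :=
  ContDiff ℝ (⊤ : ℕ∞) f1 ∧ ContDiff ℝ (⊤ : ℕ∞) f2 ∧
  (∀ z, wd f1 z = -(1/2) * (wd (cx u) z * f1 z
      + Complex.I * lam⁻¹ * Complex.exp ((u z : ℂ)) * f2 z)) ∧
  (∀ z, wd f2 z = -(1/2) * (Complex.I * Complex.exp (-(u z : ℂ)) * f1 z
      - wd (cx u) z * f2 z)) ∧
  (∀ z, wdb f1 z = -(1/2) * (-(wdb (cx u) z) * f1 z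
      + Complex.I * Complex.exp (-(u z : ℂ)) * f2 z)) ∧
  (∀ z, wdb f2 z = -(1/2) * (Complex.I * lam * Complex.exp ((u z : ℂ)) * f1 z
      + wdb (cx u) z * f2 z))

/-- The matrix `A_λ = (1/2) [[∂u, iλ⁻¹e^u], [ie^{-u}, -∂u]]`. -/
def matA (u : ℂ → ℝ) (lam : ℂ) (z : ℂ) : Matrix (Fin 2) (Fin 2) ℂ :=
  ((1:ℂ)/2) • !![wd (cx u) z, Complex.I * lam⁻¹ * Complex.exp ((u z : ℂ));
    Complex.I * Complex.exp (-(u z : ℂ)), -(wd (cx u) z)]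

/-- The matrix `B_λ = (1/2) [[-∂̄u, ie^{-u}], [iλe^u, ∂̄u]]`. -/
def matB (u : ℂ → ℝ) (lam : ℂ) (z : ℂ) : Matrix (Fin 2) (Fin 2) ℂ :=
  ((1:ℂ)/2) • !![-(wdb (cx u) z), Complex.I * Complex.exp (-(u z : ℂ));
    Complex.I * lam * Complex.exp ((u z : ℂ)), wdb (cx u) z]

lemma wd_comp {h : ℂ → ℂ} {f : ℂ → ℂ} {h' z : ℂ} (hh : HasDerivAt h h' (f z))
    (hf : DifferentiableAt ℝ f z) : wd (fun w => h (f w)) z = h' * wd f z := by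
  have key := (hh.hasFDerivAt.restrictScalars ℝ).comp z hf.hasFDerivAt
  have e : fderiv ℝ (fun w => h (f w)) z = _ := key.fderiv
  simp only [wd, e, ContinuousLinearMap.comp_apply, ContinuousLinearMap.coe_restrictScalars',
    ContinuousLinearMap.toSpanSingleton_apply, smul_eq_mul]
  ring

lemma wdb_comp {h : ℂ → ℂ} {f : ℂ → ℂ} {h' z : ℂ} (hh : HasDerivAt h h' (f z))
    (hf : DifferentiableAt ℝ f z) : wdb (fun w => h (f w)) z = h' * wdb f z := by
  have key := (hh.hasFDerivAt.restrictScalars ℝ).comp z hf.hasFDerivAt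
  have e : fderiv ℝ (fun w => h (f w)) z = _ := key.fderiv
  simp only [wdb, e, ContinuousLinearMap.comp_apply, ContinuousLinearMap.coe_restrictScalars',
    ContinuousLinearMap.toSpanSingleton_apply, smul_eq_mul]
  ring

lemma wd_sub {f g : ℂ → ℂ} {z : ℂ} (hf : DifferentiableAt ℝ f z) (hg : DifferentiableAt ℝ g z) :
    wd (fun w => f w - g w) z = wd f z - wd g z := by
  simp only [wd, fderiv_fun_sub hf hg, _root_.sub_apply]
  ring

lemma wdb_sub {f g : ℂ → ℂ} {z : ℂ} (hf : DifferentiableAt ℝ f z) (hg : DifferentiableAt ℝ g z) :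
    wdb (fun w => f w - g w) z = wdb f z - wdb g z := by
  simp only [wdb, fderiv_fun_sub hf hg, _root_.sub_apply]
  ring

lemma wd_mul {f g : ℂ → ℂ} {z : ℂ} (hf : DifferentiableAt ℝ f z) (hg : DifferentiableAt ℝ g z) :
    wd (fun w => f w * g w) z = f z * wd g z + g z * wd f z := by
  simp only [wd, fderiv_fun_mul hf hg, _root_.add_apply,
    _root_.smul_apply, smul_eq_mul]
  ring

lemma contDiff_wd {f : ℂ → ℂ} (hf : ContDiff ℝ (⊤ : ℕ∞) f) : ContDiff ℝ (⊤ : ℕ∞) (wd f) := by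
  have h := hf.fderiv_right (m := (⊤ : ℕ∞)) (by simp)
  unfold wd
  exact ((h.clm_apply contDiff_const).sub
    (contDiff_const.mul (h.clm_apply contDiff_const))).div_const 2

/-- The Wirtinger derivatives of a smooth function commute. -/
lemma wdb_wd_comm {f : ℂ → ℂ} (hf : ContDiff ℝ (⊤ : ℕ∞) f) (z : ℂ) :
    wdb (wd f) z = wd (wdb f) z := by
  have hd : DifferentiableAt ℝ (fderiv ℝ f) z :=
    ((hf.fderiv_right (m := (⊤ : ℕ∞)) (by simp)).differentiable (by simp)).differentiableAt
  have hsymm : IsSymmSndFDerivAt ℝ f z :=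
    hf.contDiffAt.isSymmSndFDerivAt (by simpa using WithTop.coe_le_coe.2 (le_top : (2 : ℕ∞) ≤ ⊤))
  have happ (v : ℂ) : HasFDerivAt (fun w => fderiv ℝ f w v)
      ((fderiv ℝ (fderiv ℝ f) z).flip v) z := by
    simpa using hd.hasFDerivAt.clm_apply (hasFDerivAt_const v z)
  have hwd : fderiv ℝ (wd f) z = _ :=
    (((happ 1).sub ((happ Complex.I).const_mul Complex.I)).mul_const (2⁻¹ : ℂ)).fderiv
  have hwdb : fderiv ℝ (wdb f) z = _ :=
    (((happ 1).add ((happ Complex.I).const_mul Complex.I)).mul_const (2⁻¹ : ℂ)).fderiv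
  rw [wdb, wd, hwd, hwdb]
  simp only [_root_.smul_apply, _root_.sub_apply,
    _root_.add_apply, ContinuousLinearMap.flip_apply, smul_eq_mul,
    hsymm.eq Complex.I 1]
  ring

/-- `ω₁ = ∂u` and `ω₂ = ∂³u - 2(∂u)³` solve the homogeneous
Jacobi equation. -/
theorem statement13 (u : ℂ → ℝ) (hu : ContDiff ℝ (⊤ : ℕ∞) u) (hsg : SinhGordon u) :
    (∀ z, wdb (wd (wd (cx u))) z + Complex.cosh (2 * (u z : ℂ)) * wd (cx u) z = 0) ∧
    (∀ z, wdb (wd (fun w => wd (wd (wd (cx u))) w - 2 * (wd (cx u) w) ^ 3)) z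
        + Complex.cosh (2 * (u z : ℂ))
            * (wd (wd (wd (cx u))) z - 2 * (wd (cx u) z) ^ 3) = 0) := by
  have hU : ContDiff ℝ (⊤ : ℕ∞) (cx u) := Complex.ofRealCLM.contDiff.comp hu
  have diff {f : ℂ → ℂ} (hf : ContDiff ℝ (⊤ : ℕ∞) f) (z : ℂ) : DifferentiableAt ℝ f z :=
    hf.differentiable (by simp) z
  have hp := contDiff_wd hU
  have hq := contDiff_wd hp
  have hr := contDiff_wd hq
  have hsinh : ContDiff ℝ (⊤ : ℕ∞) (fun w => Complex.sinh (2 * cx u w)) :=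
    (Complex.contDiff_sinh (n := (⊤ : ℕ∞)) |>.restrict_scalars ℝ).comp (contDiff_const.mul hU)
  have hcosh : ContDiff ℝ (⊤ : ℕ∞) (fun w => Complex.cosh (2 * cx u w)) :=
    (Complex.contDiff_cosh (n := (⊤ : ℕ∞)) |>.restrict_scalars ℝ).comp (contDiff_const.mul hU)
  have wd_sinh (z : ℂ) : wd (fun w => Complex.sinh (2 * cx u w)) z
      = 2 * Complex.cosh (2 * cx u z) * wd (cx u) z := by
    rw [wd_comp (h := fun x => Complex.sinh (2 * x))
      (((hasDerivAt_id (cx u z)).const_mul 2).csinh) (diff hU z)]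
    simp only [id]
    ring
  have wd_cosh (z : ℂ) : wd (fun w => Complex.cosh (2 * cx u w)) z
      = 2 * Complex.sinh (2 * cx u z) * wd (cx u) z := by
    rw [wd_comp (h := fun x => Complex.cosh (2 * x))
      (((hasDerivAt_id (cx u z)).const_mul 2).ccosh) (diff hU z)]
    simp only [id]
    ring
  have wd_sq (z : ℂ) : wd (fun w => wd (cx u) w ^ 2) z
      = 2 * wd (cx u) z * wd (wd (cx u)) z := by
    rw [wd_comp (h := fun x => x ^ 2) (hasDerivAt_pow 2 _) (diff hp z)]
    norm_num
  have wdb_p : wdb (wd (cx u)) = fun z => -(1 / 2) * Complex.sinh (2 * cx u z) := by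
    funext z
    rw [wdb_wd_comm hU]
    linear_combination (norm := (simp only [cx]; ring)) hsg z
  have wdb_q : wdb (wd (wd (cx u))) = fun z => 0 - Complex.cosh (2 * cx u z) * wd (cx u) z := by
    funext z
    rw [wdb_wd_comm hp, wdb_p, wd_comp (h := fun x => -(1 / 2) * x)
      ((hasDerivAt_id _).const_mul _) (diff hsinh z), wd_sinh]
    ring
  have wdb_r (z : ℂ) : wdb (wd (wd (wd (cx u)))) z
      = -(2 * Complex.sinh (2 * cx u z) * wd (cx u) z ^ 2
        + Complex.cosh (2 * cx u z) * wd (wd (cx u)) z) := by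
    rw [wdb_wd_comm hq, wdb_q, wd_comp (h := fun x => 0 - x)
      ((hasDerivAt_id _).const_sub 0) (diff (hcosh.mul hp) z),
      wd_mul (diff hcosh z) (diff hp z), wd_cosh]
    ring
  have hcube : ContDiff ℝ (⊤ : ℕ∞) (fun w => 2 * wd (cx u) w ^ 3) := contDiff_const.mul (hp.pow 3)
  have wdb_omega : wdb (fun w => wd (wd (wd (cx u))) w - 2 * (wd (cx u) w) ^ 3)
      = fun z => Complex.sinh (2 * cx u z) * wd (cx u) z ^ 2
        - Complex.cosh (2 * cx u z) * wd (wd (cx u)) z := by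
    funext z
    rw [wdb_sub (diff hr z) (diff hcube z), wdb_r, wdb_comp (h := fun x => 2 * x ^ 3)
      ((hasDerivAt_pow 3 _).const_mul 2) (diff hp z), wdb_p]
    norm_num
    ring
  refine ⟨fun z => ?_, fun z => ?_⟩
  · rw [wdb_q]
    simp only [cx]
    ring
  · rw [wdb_wd_comm (hr.sub hcube), wdb_omega,
      wd_sub (diff (hsinh.mul (hp.pow 2)) z) (diff (hcosh.mul hq) z),
      wd_mul (diff hsinh z) (diff (hp.pow 2) z), wd_mul (diff hcosh z) (diff hq z),
      wd_sinh, wd_cosh, wd_sq]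
    simp only [cx]
    ring
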